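/- Let d ≥ 1 and m ≥ 1 be integers, K > 0 and 0 < ε ≤ K. Let c : ℝᵈ → ℝᵈ be (m+1) times continuously differentiable with |∂^γ c^i(x)| ≤ ε for all x, all 1 ≤ i ≤ d and all multi-indices γ with |γ| ≤ m+1, and suppose |det(𝕀 + θ·Dc(x))| ≥ K⁻¹ for all x ∈ ℝᵈ and θ ∈ [0,1]. Then there exists a constant N depending only on m, d and K such that for every (m+1) times continuously differentiable, compactly supported function u : ℝᵈ → ℝ, all multi-indices α, β with |α| ≤ m, 0 ≠ β ≤ α, and all 1 ≤ ρ ≤ d: | ∫_{ℝᵈ} ∂^β c^ρ(x) [ (∂_ρ ∂^{α−β} u · ∂^α u)(x + c(x)) − (∂_ρ ∂^{α−β} u · ∂^α u)(x) ] dx | ≤ N ε² Σ_{|ζ| ≤ m} ∫_{ℝᵈ} |∂^ζ u(x)|² dx. -/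

import Mathlib

open MeasureTheory Finset
open scoped ENNReal

/-- Partial derivative in direction `i`. -/
noncomputable def pd {d : ℕ} (i : Fin d) (f : EuclideanSpace ℝ (Fin d) → ℝ) :
    EuclideanSpace ℝ (Fin d) → ℝ :=
  fun x => fderiv ℝ f x (EuclideanSpace.single i 1)

/-- Multi-index partial derivative `∂^ζ`. -/
noncomputable def mpd {d : ℕ} (ζ : Fin d → ℕ) (f : EuclideanSpace ℝ (Fin d) → ℝ) :
    EuclideanSpace ℝ (Fin d) → ℝ :=
  (List.finRange d).foldr (fun i g => (pd i)^[ζ i] g) f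

/-- Jacobian matrix of a map `ℝᵈ → ℝᵈ`. -/
noncomputable def jac {d : ℕ} (c : EuclideanSpace ℝ (Fin d) → EuclideanSpace ℝ (Fin d))
    (x : EuclideanSpace ℝ (Fin d)) : Matrix (Fin d) (Fin d) ℝ :=
  Matrix.of fun i j => fderiv ℝ (fun y => c y i) x (EuclideanSpace.single j 1)

/-- The finite set of multi-indices `ζ ∈ ℕᵈ` with `|ζ| ≤ n`. -/
def midx (d n : ℕ) : Finset (Fin d → ℕ) :=
  (Finset.univ.image (fun f : Fin d → Fin (n + 1) => fun i => (f i : ℕ))).filter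
    (fun ζ => ∑ i, ζ i ≤ n)

theorem ContDiff.pd {d n : ℕ} {f : EuclideanSpace ℝ (Fin d) → ℝ} (i : Fin d)
    (hf : ContDiff ℝ (n + 1 : ℕ) f) : ContDiff ℝ n (pd i f) := by
  have h : ContDiff ℝ n (fderiv ℝ f) := hf.fderiv_right (by norm_cast)
  exact h.clm_apply contDiff_const

theorem pd_comm {d : ℕ} {f : EuclideanSpace ℝ (Fin d) → ℝ} (i j : Fin d)
    (hf : ContDiff ℝ (2 : ℕ) f) : pd i (pd j f) = pd j (pd i f) := by
  have h1 : Differentiable ℝ (fderiv ℝ f) :=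
    (hf.fderiv_right (m := 1) (by norm_cast)).differentiable (by simp)
  have key : ∀ (a b : Fin d) x, pd a (pd b f) x =
      fderiv ℝ (fderiv ℝ f) x (EuclideanSpace.single a 1) (EuclideanSpace.single b 1) := by
    intro a b x
    unfold pd
    rw [fderiv_clm_apply (h1 x) (differentiableAt_const _)]
    simp
  funext x
  rw [key, key]
  exact (hf.contDiffAt.isSymmSndFDerivAt (by simp)) _ _

theorem ContDiff.iterate_pd {d : ℕ} (i : Fin d) (k : ℕ) :
    ∀ {n : ℕ} {f : EuclideanSpace ℝ (Fin d) → ℝ},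
      ContDiff ℝ (n + k : ℕ) f → ContDiff ℝ n ((_root_.pd i)^[k] f) := by
  induction k with
  | zero => intro n f hf; simpa using hf
  | succ k ih =>
    intro n f hf
    rw [Function.iterate_succ_apply]
    exact ih (ContDiff.pd i hf)

theorem pd_iterate_comm {d : ℕ} (i j : Fin d) (k : ℕ) :
    ∀ {f : EuclideanSpace ℝ (Fin d) → ℝ}, ContDiff ℝ (k + 1 : ℕ) f →
      (pd i)^[k] (pd j f) = pd j ((pd i)^[k] f) := by
  induction k with
  | zero => intro f _; rfl
  | succ k ih =>
    intro f hf
    rw [Function.iterate_succ_apply, pd_comm i j (hf.of_le (by norm_cast; omega)),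
      ih (ContDiff.pd i hf), Function.iterate_succ_apply]

theorem ContDiff.foldr_pd {d : ℕ} (ζ : Fin d → ℕ) (l : List (Fin d)) :
    ∀ {n : ℕ} {f : EuclideanSpace ℝ (Fin d) → ℝ}, ContDiff ℝ (n + (l.map ζ).sum : ℕ) f →
      ContDiff ℝ n (l.foldr (fun i g => (_root_.pd i)^[ζ i] g) f) := by
  induction l with
  | nil => intro n f hf; simpa using hf
  | cons i l ih =>
    intro n f hf
    rw [List.foldr_cons]
    refine ContDiff.iterate_pd i (ζ i) (ih ?_)
    simpa [add_assoc] using hf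

theorem foldr_pd_comm {d : ℕ} (ζ : Fin d → ℕ) (j : Fin d) (l : List (Fin d))
    {f : EuclideanSpace ℝ (Fin d) → ℝ} (hf : ContDiff ℝ ((l.map ζ).sum + 1 : ℕ) f) :
    l.foldr (fun i g => (pd i)^[ζ i] g) (pd j f) =
      pd j (l.foldr (fun i g => (pd i)^[ζ i] g) f) := by
  induction l with
  | nil => rfl
  | cons i l ih =>
    have hle : (l.map ζ).sum + 1 ≤ ((i :: l).map ζ).sum + 1 := by simp
    rw [List.foldr_cons, List.foldr_cons, ih (hf.of_le (by exact_mod_cast hle)),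
      pd_iterate_comm]
    refine ContDiff.foldr_pd ζ l (hf.of_le ?_)
    simp only [List.map_cons, List.sum_cons]
    norm_cast
    omega

theorem foldr_pd_add_single {d : ℕ} (ζ : Fin d → ℕ) (j : Fin d) (l : List (Fin d))
    (hl : l.Nodup) {f : EuclideanSpace ℝ (Fin d) → ℝ}
    (hf : ContDiff ℝ ((l.map ζ).sum + 1 : ℕ) f) :
    l.foldr (fun i g => (pd i)^[(ζ + Pi.single j 1 : Fin d → ℕ) i] g) f =
      if j ∈ l then pd j (l.foldr (fun i g => (pd i)^[ζ i] g) f)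
      else l.foldr (fun i g => (pd i)^[ζ i] g) f := by
  induction l with
  | nil => rfl
  | cons i l ih =>
    have hle : (l.map ζ).sum + 1 ≤ ((i :: l).map ζ).sum + 1 := by simp
    rw [List.nodup_cons] at hl
    rw [List.foldr_cons, List.foldr_cons, ih hl.2 (hf.of_le (by exact_mod_cast hle))]
    by_cases hij : i = j
    · subst hij
      simp [hl.1, Function.iterate_succ_apply']
    · have hz : (ζ + Pi.single j 1 : Fin d → ℕ) i = ζ i := by simp [hij]
      rw [hz]
      by_cases hj : j ∈ l
      · simp only [hj, if_true, List.mem_cons, or_true]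
        refine pd_iterate_comm i j _ (ContDiff.foldr_pd ζ l (hf.of_le ?_))
        simp only [List.map_cons, List.sum_cons]
        norm_cast
        omega
      · simp [hj, Ne.symm hij]

theorem sum_map_finRange {d : ℕ} (ζ : Fin d → ℕ) :
    ((List.finRange d).map ζ).sum = ∑ i, ζ i := by
  rw [Fin.sum_univ_def]

theorem ContDiff.mpd {d n : ℕ} (ζ : Fin d → ℕ) {f : EuclideanSpace ℝ (Fin d) → ℝ}
    (hf : ContDiff ℝ (n + ∑ i, ζ i : ℕ) f) : ContDiff ℝ n (mpd ζ f) :=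
  ContDiff.foldr_pd ζ _ (by rwa [sum_map_finRange])

theorem mpd_pd {d : ℕ} (ζ : Fin d → ℕ) (j : Fin d) {f : EuclideanSpace ℝ (Fin d) → ℝ}
    (hf : ContDiff ℝ (∑ i, ζ i + 1 : ℕ) f) : mpd ζ (pd j f) = pd j (mpd ζ f) :=
  foldr_pd_comm ζ j _ (by rwa [sum_map_finRange])

theorem mpd_add_single {d : ℕ} (ζ : Fin d → ℕ) (j : Fin d)
    {f : EuclideanSpace ℝ (Fin d) → ℝ} (hf : ContDiff ℝ (∑ i, ζ i + 1 : ℕ) f) :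
    mpd (ζ + Pi.single j 1) f = pd j (mpd ζ f) := by
  have := foldr_pd_add_single ζ j (List.finRange d) (List.nodup_finRange d)
    (f := f) (by rwa [sum_map_finRange])
  simpa [mpd] using this

theorem mpd_zero {d : ℕ} (f : EuclideanSpace ℝ (Fin d) → ℝ) : mpd 0 f = f := by
  have : ∀ l : List (Fin d),
      l.foldr (fun i g => (pd i)^[(0 : Fin d → ℕ) i] g) f = f := by
    intro l
    induction l with
    | nil => rfl
    | cons i l ih => rw [List.foldr_cons, ih]; rfl
  exact this _

theorem HasCompactSupport.pd {d : ℕ} (i : Fin d) {f : EuclideanSpace ℝ (Fin d) → ℝ}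
    (hf : HasCompactSupport f) : HasCompactSupport (pd i f) :=
  (hf.fderiv (𝕜 := ℝ)).comp_left
    (g := fun L : EuclideanSpace ℝ (Fin d) →L[ℝ] ℝ => L (EuclideanSpace.single i 1)) rfl

theorem HasCompactSupport.mpd {d : ℕ} (ζ : Fin d → ℕ) {f : EuclideanSpace ℝ (Fin d) → ℝ}
    (hf : HasCompactSupport f) : HasCompactSupport (mpd ζ f) := by
  have iter : ∀ (i : Fin d) (k : ℕ) (g : EuclideanSpace ℝ (Fin d) → ℝ),
      HasCompactSupport g → HasCompactSupport ((_root_.pd i)^[k] g) := by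
    intro i k
    induction k with
    | zero => intro g hg; exact hg
    | succ k ih =>
      intro g hg
      rw [Function.iterate_succ_apply]
      exact ih _ (HasCompactSupport.pd i hg)
  have : ∀ l : List (Fin d),
      HasCompactSupport (l.foldr (fun i g => (_root_.pd i)^[ζ i] g) f) := by
    intro l
    induction l with
    | nil => exact hf
    | cons i l ih => exact iter _ _ _ ih
  exact this _

theorem lintegral_comp_le_of_injOn_ball {E : Type*} [NormedAddCommGroup E] [NormedSpace ℝ E]
    [FiniteDimensional ℝ E] [MeasurableSpace E] [BorelSpace E] (μ : Measure E)
    [μ.IsAddHaarMeasure] {τ : E → E} {τ' : E → E →L[ℝ] E}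
    (hτ : ∀ x, HasFDerivAt τ (τ' x) x) {K : ℝ} (hK : 0 < K)
    (hdet : ∀ x, K⁻¹ ≤ |(τ' x).det|) {R r : ℝ} (hr : 0 < r)
    (hR : ∀ x, dist (τ x) x ≤ R) (hinj : ∀ z, Set.InjOn τ (Metric.ball z r))
    {G : E → ℝ≥0∞} (hG : Measurable G) :
    ∫⁻ x, G (τ x) ∂μ ≤
      ENNReal.ofReal K * μ (Metric.ball 0 (r + R)) / μ (Metric.ball 0 r) * ∫⁻ x, G x ∂μ := by
  have hτm : Measurable τ :=
    (continuous_iff_continuousAt.2 fun x => (hτ x).continuousAt).measurable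
  have avg : ∀ (H : E → ℝ≥0∞), Measurable H → ∀ s : ℝ,
      ∫⁻ z, ∫⁻ x in Metric.ball z s, H x ∂μ ∂μ = μ (Metric.ball 0 s) * ∫⁻ x, H x ∂μ := by
    intro H hH s
    have hS : MeasurableSet {p : E × E | dist p.2 p.1 < s} :=
      (isOpen_lt (continuous_snd.dist continuous_fst) continuous_const).measurableSet
    calc ∫⁻ z, ∫⁻ x in Metric.ball z s, H x ∂μ ∂μ
        = ∫⁻ z, ∫⁻ x, {p : E × E | dist p.2 p.1 < s}.indicator (fun p => H p.2) (z, x) ∂μ ∂μ := by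
          refine lintegral_congr fun z => ?_
          rw [← lintegral_indicator measurableSet_ball]
          rfl
      _ = ∫⁻ x, ∫⁻ z, {p : E × E | dist p.2 p.1 < s}.indicator (fun p => H p.2) (z, x) ∂μ ∂μ :=
          lintegral_lintegral_swap
            ((hH.comp measurable_snd).indicator hS).aemeasurable
      _ = ∫⁻ x, μ (Metric.ball 0 s) * H x ∂μ := by
          refine lintegral_congr fun x => ?_
          have : (fun z => {p : E × E | dist p.2 p.1 < s}.indicator (fun p => H p.2) (z, x)) =
              (Metric.ball x s).indicator (fun _ => H x) := by
            funext z
            by_cases hz : z ∈ Metric.ball x s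
            · rw [Set.indicator_of_mem hz,
                Set.indicator_of_mem (by exact Metric.mem_ball'.1 hz)]
            · rw [Set.indicator_of_notMem hz,
                Set.indicator_of_notMem (by exact fun h => hz (Metric.mem_ball'.2 h))]
          rw [this, lintegral_indicator measurableSet_ball, lintegral_const,
            Measure.restrict_apply_univ, Measure.addHaar_ball_center, mul_comm]
      _ = _ := lintegral_const_mul _ hH
  have hball : μ (Metric.ball (0 : E) r) ≠ 0 := (Metric.measure_ball_pos μ 0 hr).ne'
  have hball' : μ (Metric.ball (0 : E) r) ≠ ⊤ := measure_ball_lt_top.ne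
  have local_le : ∀ z, ∫⁻ x in Metric.ball z r, G (τ x) ∂μ ≤
      ENNReal.ofReal K * ∫⁻ x in Metric.ball z (r + R), G x ∂μ := by
    intro z
    calc ∫⁻ x in Metric.ball z r, G (τ x) ∂μ
        ≤ ∫⁻ x in Metric.ball z r,
            ENNReal.ofReal K * (ENNReal.ofReal |(τ' x).det| * G (τ x)) ∂μ := by
          refine lintegral_mono fun x => ?_
          rw [← mul_assoc, ← ENNReal.ofReal_mul hK.le]
          refine le_mul_of_one_le_left (zero_le) ?_
          rw [ENNReal.one_le_ofReal]
          calc (1 : ℝ) = K * K⁻¹ := (mul_inv_cancel₀ hK.ne').symm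
            _ ≤ _ := by gcongr; exact hdet x
      _ = ENNReal.ofReal K * ∫⁻ x in τ '' Metric.ball z r, G x ∂μ := by
          rw [lintegral_const_mul' _ _ ENNReal.ofReal_ne_top,
            lintegral_image_eq_lintegral_abs_det_fderiv_mul μ measurableSet_ball
              (fun x _ => (hτ x).hasFDerivWithinAt) (hinj z)]
      _ ≤ _ := by
          gcongr
          rintro _ ⟨x, hx, rfl⟩
          rw [Metric.mem_ball] at hx ⊢
          linarith [dist_triangle (τ x) x z, hR x]
  have main : μ (Metric.ball 0 r) * ∫⁻ x, G (τ x) ∂μ ≤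
      ENNReal.ofReal K * (μ (Metric.ball 0 (r + R)) * ∫⁻ x, G x ∂μ) := by
    rw [← avg (fun x => G (τ x)) (hG.comp hτm), ← avg G hG,
      ← lintegral_const_mul' _ _ ENNReal.ofReal_ne_top]
    exact lintegral_mono local_le
  calc ∫⁻ x, G (τ x) ∂μ
      ≤ ENNReal.ofReal K * (μ (Metric.ball 0 (r + R)) * ∫⁻ x, G x ∂μ) / μ (Metric.ball 0 r) := by
        rw [ENNReal.le_div_iff_mul_le (Or.inl hball) (Or.inl hball'), mul_comm]
        exact main
    _ = _ := by simp only [div_eq_mul_inv]; ring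

open scoped Matrix

theorem norm_le_sum_abs {d : ℕ} (v : EuclideanSpace ℝ (Fin d)) : ‖v‖ ≤ ∑ i, |v i| := by
  rw [EuclideanSpace.norm_eq, Real.sqrt_le_left (by positivity)]
  simpa using Finset.sum_sq_le_sq_sum_of_nonneg (s := Finset.univ) (f := fun i => ‖v i‖)
    (fun i _ => norm_nonneg _)

theorem norm_le_of_forall_abs_le {d : ℕ} {v : EuclideanSpace ℝ (Fin d)} {B : ℝ}
    (h : ∀ i, |v i| ≤ B) : ‖v‖ ≤ d * B := by
  refine (norm_le_sum_abs v).trans ((Finset.sum_le_sum fun i _ => h i).trans ?_)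
  simp

theorem clm_apply_eq_sum_single {d : ℕ} {F : Type*} [NormedAddCommGroup F] [NormedSpace ℝ F]
    (L : EuclideanSpace ℝ (Fin d) →L[ℝ] F) (v : EuclideanSpace ℝ (Fin d)) :
    L v = ∑ j, v j • L (EuclideanSpace.single j 1) := by
  conv_lhs => rw [← (EuclideanSpace.basisFun (Fin d) ℝ).sum_repr v]
  simp

theorem norm_clm_le_of_forall_single {d : ℕ} {F : Type*} [NormedAddCommGroup F]
    [NormedSpace ℝ F] {L : EuclideanSpace ℝ (Fin d) →L[ℝ] F} {B : ℝ} (hB : 0 ≤ B)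
    (h : ∀ j, ‖L (EuclideanSpace.single j 1)‖ ≤ B) : ‖L‖ ≤ d * B := by
  refine L.opNorm_le_bound (by positivity) fun v => ?_
  rw [clm_apply_eq_sum_single L v]
  calc ‖∑ j, v j • L (EuclideanSpace.single j 1)‖
      ≤ ∑ j : Fin d, ‖v‖ * B := by
        refine norm_sum_le_of_le _ fun j _ => ?_
        rw [norm_smul]
        exact mul_le_mul (PiLp.norm_apply_le v j) (h j) (norm_nonneg _) (norm_nonneg _)
    _ = d * B * ‖v‖ := by simp; ring

theorem norm_fderiv_le_of_pd {d : ℕ} {f : EuclideanSpace ℝ (Fin d) → ℝ} {B : ℝ} (hB : 0 ≤ B)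
    {x : EuclideanSpace ℝ (Fin d)} (h : ∀ j, |pd j f x| ≤ B) : ‖fderiv ℝ f x‖ ≤ d * B :=
  norm_clm_le_of_forall_single hB h

theorem abs_sub_le_of_pd {d : ℕ} {f : EuclideanSpace ℝ (Fin d) → ℝ} {B : ℝ} (hB : 0 ≤ B)
    (hf : Differentiable ℝ f) (h : ∀ j x, |pd j f x| ≤ B) (x y : EuclideanSpace ℝ (Fin d)) :
    |f x - f y| ≤ d * B * ‖x - y‖ :=
  Convex.norm_image_sub_le_of_norm_fderiv_le (s := Set.univ) (fun z _ => hf z)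
    (fun z _ => norm_fderiv_le_of_pd hB fun j => h j z) convex_univ trivial trivial

theorem fderiv_apply_coord {d : ℕ} {c : EuclideanSpace ℝ (Fin d) → EuclideanSpace ℝ (Fin d)}
    (hc : Differentiable ℝ c) (i : Fin d) (x v : EuclideanSpace ℝ (Fin d)) :
    (fderiv ℝ c x v) i = fderiv ℝ (fun y => c y i) x v := by
  have h := ((EuclideanSpace.proj i : EuclideanSpace ℝ (Fin d) →L[ℝ] ℝ).hasFDerivAt
    (x := c x)).comp x (hc x).hasFDerivAt
  have h2 : HasFDerivAt (fun y => c y i)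
    ((EuclideanSpace.proj i : EuclideanSpace ℝ (Fin d) →L[ℝ] ℝ).comp (fderiv ℝ c x)) x := h
  rw [h2.fderiv]
  rfl

theorem norm_fderiv_vec_le {d : ℕ} {c : EuclideanSpace ℝ (Fin d) → EuclideanSpace ℝ (Fin d)}
    (hc : Differentiable ℝ c) {B : ℝ} (hB : 0 ≤ B) {x : EuclideanSpace ℝ (Fin d)}
    (h : ∀ i j, |pd j (fun y => c y i) x| ≤ B) : ‖fderiv ℝ c x‖ ≤ d * (d * B) := by
  refine norm_clm_le_of_forall_single (by positivity) fun j => norm_le_of_forall_abs_le fun i => ?_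
  rw [fderiv_apply_coord hc]
  exact h i j

theorem norm_fderiv_vec_sub_le {d : ℕ}
    {c : EuclideanSpace ℝ (Fin d) → EuclideanSpace ℝ (Fin d)}
    (hc : Differentiable ℝ c) {B : ℝ} (hB : 0 ≤ B)
    (hd : ∀ i j, Differentiable ℝ (pd j (fun y => c y i)))
    (h : ∀ i j k x, |pd k (pd j (fun y => c y i)) x| ≤ B) (x y : EuclideanSpace ℝ (Fin d)) :
    ‖fderiv ℝ c x - fderiv ℝ c y‖ ≤ d * (d * (d * B * ‖x - y‖)) := by
  refine norm_clm_le_of_forall_single (by positivity) fun j => norm_le_of_forall_abs_le fun i => ?_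
  rw [sub_apply, PiLp.sub_apply, fderiv_apply_coord hc, fderiv_apply_coord hc]
  exact abs_sub_le_of_pd hB (hd i j) (fun k x => h i j k x) x y

theorem fderiv_apply_eq_jac_mulVec {d : ℕ}
    {c : EuclideanSpace ℝ (Fin d) → EuclideanSpace ℝ (Fin d)}
    (hc : Differentiable ℝ c) (x v : EuclideanSpace ℝ (Fin d)) :
    fderiv ℝ c x v = WithLp.toLp 2 (jac c x *ᵥ v.ofLp) := by
  ext i
  rw [fderiv_apply_coord hc, clm_apply_eq_sum_single]
  simp [Matrix.mulVec, dotProduct, jac, mul_comm]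

theorem det_id_add_fderiv {d : ℕ} {c : EuclideanSpace ℝ (Fin d) → EuclideanSpace ℝ (Fin d)}
    (hc : Differentiable ℝ c) (x : EuclideanSpace ℝ (Fin d)) :
    (ContinuousLinearMap.id ℝ (EuclideanSpace ℝ (Fin d)) + fderiv ℝ c x).det =
      (1 + jac c x).det := by
  rw [ContinuousLinearMap.det, ← LinearMap.det_toMatrix (EuclideanSpace.basisFun (Fin d) ℝ).toBasis]
  congr 1
  ext i j
  simp [LinearMap.toMatrix_apply, jac, fderiv_apply_coord hc, Matrix.one_apply]

theorem norm_le_of_det_of_mulVec {d : ℕ} {A : Matrix (Fin d) (Fin d) ℝ} {K B : ℝ} (hK : 0 < K)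
    (hB : 1 ≤ B) (hA : ∀ i j, |A i j| ≤ B) (hdet : K⁻¹ ≤ |A.det|)
    (v : EuclideanSpace ℝ (Fin d)) :
    ‖v‖ ≤ d * (d * (K * (d.factorial * B ^ d))) * ‖WithLp.toLp 2 (A *ᵥ v.ofLp)‖ := by
  have hdpos : 0 < |A.det| := (inv_pos.2 hK).trans_le hdet
  have hadj : ∀ i j, |A.adjugate i j| ≤ d.factorial * B ^ d := by
    intro i j
    rw [Matrix.adjugate_apply]
    have := Matrix.det_le (A := A.updateRow j (Pi.single i 1)) (abv := AbsoluteValue.abs)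
      (x := B) (fun a b => ?_)
    · simpa using this
    · by_cases ha : a = j
      · subst ha
        by_cases hb : b = i
        · subst hb; simpa using hB
        · simp [hb]; linarith
      · simpa [ha] using hA a b
  have hdet_le : |A.det|⁻¹ ≤ K := inv_le_of_inv_le₀ hK hdet
  set w := A *ᵥ v.ofLp with hw
  have hAv : A.adjugate *ᵥ w = A.det • v.ofLp := by
    rw [hw, Matrix.mulVec_mulVec, Matrix.adjugate_mul, Matrix.smul_mulVec, Matrix.one_mulVec]
  rw [show (d : ℝ) * (d * (K * (d.factorial * B ^ d))) * ‖WithLp.toLp 2 w‖ =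
    d * (d * (K * (d.factorial * B ^ d)) * ‖WithLp.toLp 2 w‖) by ring]
  refine norm_le_of_forall_abs_le fun i => ?_
  have hi : v i = A.det⁻¹ * ∑ j, A.adjugate i j * w j := by
    have := congrFun hAv i
    simp only [Matrix.mulVec, dotProduct, Pi.smul_apply, smul_eq_mul] at this
    rw [this, inv_mul_cancel_left₀ (abs_pos.1 hdpos)]
  rw [hi, abs_mul, abs_inv]
  calc |A.det|⁻¹ * |∑ j, A.adjugate i j * w j|
      ≤ K * ∑ j : Fin d, (d.factorial * B ^ d) * ‖WithLp.toLp 2 w‖ := by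
        gcongr
        refine (Finset.abs_sum_le_sum_abs _ _).trans (Finset.sum_le_sum fun j _ => ?_)
        rw [abs_mul]
        exact mul_le_mul (hadj i j) (PiLp.norm_apply_le (WithLp.toLp 2 w) j) (abs_nonneg _)
          (by positivity)
    _ = _ := by simp; ring

theorem exists_abs_det_one_add_sub_one_le (d : ℕ) :
    ∃ δ > (0 : ℝ), ∃ C : ℝ, 0 ≤ C ∧ ∀ (A : Matrix (Fin d) (Fin d) ℝ) (ε : ℝ), 0 ≤ ε → ε ≤ δ →
      (∀ i j, |A i j| ≤ ε) → abs (1 - |(1 + A).det|) ≤ C * ε := by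
  have hdiff : Differentiable ℝ
      (fun B : Fin d → Fin d → ℝ => (1 + Matrix.of B : Matrix (Fin d) (Fin d) ℝ).det) := by
    simp only [Matrix.det_apply, Matrix.add_apply, Matrix.of_apply]
    fun_prop
  have hO := (hdiff 0).isBigO_sub
  obtain ⟨C, hC, hb⟩ := hO.exists_nonneg
  obtain ⟨δ, hδ, hball⟩ := Metric.eventually_nhds_iff.1 hb.bound
  refine ⟨δ / 2, by positivity, C, hC, fun A ε hε hεδ hA => ?_⟩
  have hnorm : ‖(fun i j => A i j : Fin d → Fin d → ℝ)‖ ≤ ε :=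
    (pi_norm_le_iff_of_nonneg hε).2 fun i => (pi_norm_le_iff_of_nonneg hε).2 fun j => hA i j
  have h := @hball (fun i j => A i j) (by rw [dist_zero_right]; linarith)
  have h0 : (1 + Matrix.of (0 : Fin d → Fin d → ℝ) : Matrix (Fin d) (Fin d) ℝ).det = 1 := by
    simp
  rw [h0, sub_zero, Real.norm_eq_abs] at h
  have h1 : abs (1 - |(1 + A).det|) ≤ |(1 + A).det - 1| := by
    rw [abs_sub_comm]
    simpa using abs_abs_sub_abs_le (1 + A).det 1
  exact h1.trans (h.trans (by gcongr))

theorem eq_of_add_eq_add_of_dist_lt {d : ℕ}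
    {c : EuclideanSpace ℝ (Fin d) → EuclideanSpace ℝ (Fin d)}
    (hc : Differentiable ℝ c) {L Λ : ℝ} (hL : 0 < L) (hΛ : 0 < Λ)
    (hlip : ∀ x y, ‖fderiv ℝ c x - fderiv ℝ c y‖ ≤ Λ * ‖x - y‖)
    (hinv : ∀ x v, ‖v‖ ≤ L * ‖v + fderiv ℝ c x v‖) {x y : EuclideanSpace ℝ (Fin d)}
    (hxy : dist x y < (L * Λ)⁻¹) (h : x + c x = y + c y) : x = y := by
  have hb : ‖c x - c y - fderiv ℝ c y (x - y)‖ ≤ Λ * ‖x - y‖ * ‖x - y‖ := by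
    refine Convex.norm_image_sub_le_of_norm_fderiv_le' (𝕜 := ℝ)
      (s := Metric.closedBall y ‖x - y‖) (fun z _ => hc z) (fun z hz => ?_)
      (convex_closedBall _ _) (Metric.mem_closedBall_self (norm_nonneg _))
      (by rw [Metric.mem_closedBall, dist_eq_norm])
    refine (hlip z y).trans ?_
    rw [Metric.mem_closedBall, dist_eq_norm] at hz
    gcongr
  have hcc : c x - c y = -(x - y) := by
    have : c x = y + c y - x := by rw [← h]; abel
    rw [this]; abel
  have hi := hinv y (x - y)
  have he : ‖x - y + fderiv ℝ c y (x - y)‖ = ‖c x - c y - fderiv ℝ c y (x - y)‖ := by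
    rw [hcc, ← norm_neg]
    congr 1
    abel
  rw [he] at hi
  by_contra hne
  have hpos : 0 < ‖x - y‖ := norm_pos_iff.2 (sub_ne_zero.2 hne)
  rw [dist_eq_norm, lt_inv_comm₀ hpos (by positivity)] at hxy
  have h1 : ‖x - y‖ ≤ L * Λ * ‖x - y‖ * ‖x - y‖ := by
    calc ‖x - y‖ ≤ L * (Λ * ‖x - y‖ * ‖x - y‖) := hi.trans (by gcongr)
      _ = _ := by ring
  have h2 : L * Λ * ‖x - y‖ < 1 := by
    calc L * Λ * ‖x - y‖ < ‖x - y‖⁻¹ * ‖x - y‖ := by gcongr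
      _ = 1 := inv_mul_cancel₀ hpos.ne'
  nlinarith

theorem bijective_add_of_lipschitz {E : Type*} [NormedAddCommGroup E] [CompleteSpace E]
    {c : E → E} (hc : LipschitzWith (1 / 2) c) : Function.Bijective fun x => x + c x := by
  have hcontr : ∀ y, ContractingWith (1 / 2) fun x => y - c x := by
    intro y
    refine ⟨by rw [← NNReal.coe_lt_coe]; norm_num, LipschitzWith.of_dist_le_mul fun a b => ?_⟩
    rw [dist_sub_left]
    exact hc.dist_le_mul a b
  refine ⟨fun a b hab => ?_, fun y => ?_⟩
  · refine (hcontr (a + c a)).fixedPoint_unique' ?_ ?_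
    · exact add_sub_cancel_right a (c a)
    · have hab' : a + c a = b + c b := hab
      change a + c a - c b = b
      rw [hab', add_sub_cancel_right]
  · have : Nonempty E := ⟨y⟩
    refine ⟨ContractingWith.fixedPoint _ (hcontr y), ?_⟩
    exact (sub_eq_iff_eq_add.1 (hcontr y).fixedPoint_isFixedPt).symm

theorem exists_lintegral_comp_add_le (d : ℕ) {K : ℝ} (hK : 0 < K) :
    ∃ P : ℝ≥0∞, P ≠ ⊤ ∧ ∀ c : EuclideanSpace ℝ (Fin d) → EuclideanSpace ℝ (Fin d),
      Differentiable ℝ c → (∀ i j, Differentiable ℝ (pd j (fun y => c y i))) →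
      (∀ i x, |c x i| ≤ K) → (∀ i j x, |pd j (fun y => c y i) x| ≤ K) →
      (∀ i j k x, |pd k (pd j (fun y => c y i)) x| ≤ K) →
      (∀ x, K⁻¹ ≤ |(1 + jac c x).det|) →
      ∀ G : EuclideanSpace ℝ (Fin d) → ℝ≥0∞, Measurable G →
        ∫⁻ x, G (x + c x) ≤ P * ∫⁻ x, G x := by
  set L : ℝ := d * (d * (K * (d.factorial * (1 + K) ^ d))) + 1 with hLdef
  set Λ : ℝ := d * (d * (d * K)) + 1 with hΛdef
  have hL : 0 < L := by positivity
  have hΛ : 0 < Λ := by positivity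
  set r : ℝ := (L * Λ)⁻¹ / 2 with hr
  have hrpos : 0 < r := by positivity
  refine ⟨ENNReal.ofReal K * volume (Metric.ball (0 : EuclideanSpace ℝ (Fin d)) (r + d * K)) /
    volume (Metric.ball (0 : EuclideanSpace ℝ (Fin d)) r), ?_, ?_⟩
  · exact ENNReal.div_ne_top (ENNReal.mul_ne_top ENNReal.ofReal_ne_top measure_ball_lt_top.ne)
      (Metric.measure_ball_pos volume 0 hrpos).ne'
  intro c hc hpd h0 h1 h2 hdet G hG
  have hlip : ∀ x y, ‖fderiv ℝ c x - fderiv ℝ c y‖ ≤ Λ * ‖x - y‖ := by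
    intro x y
    refine (norm_fderiv_vec_sub_le hc hK.le hpd h2 x y).trans ?_
    rw [hΛdef]
    nlinarith [norm_nonneg (x - y)]
  have hinv : ∀ x v, ‖v‖ ≤ L * ‖v + fderiv ℝ c x v‖ := by
    intro x v
    have hentry : ∀ i j, |(1 + jac c x) i j| ≤ 1 + K := by
      intro i j
      refine (abs_add_le _ _).trans (add_le_add ?_ (h1 i j x))
      rw [Matrix.one_apply]
      split_ifs <;> simp
    have h := norm_le_of_det_of_mulVec hK (by linarith) hentry (hdet x) v
    have he : WithLp.toLp 2 ((1 + jac c x) *ᵥ v.ofLp) = v + fderiv ℝ c x v := by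
      rw [fderiv_apply_eq_jac_mulVec hc, Matrix.add_mulVec, Matrix.one_mulVec]
      rfl
    rw [he] at h
    refine h.trans ?_
    gcongr
    linarith
  refine lintegral_comp_le_of_injOn_ball volume (τ := fun x => x + c x)
    (fun x => (hasFDerivAt_id x).add (hc x).hasFDerivAt) hK (fun x => ?_) hrpos (fun x => ?_)
    (fun z x hx y hy hxy => ?_) hG
  · rw [det_id_add_fderiv hc]
    exact hdet x
  · rw [dist_eq_norm, add_sub_cancel_left]
    exact norm_le_of_forall_abs_le fun i => h0 i x
  · refine eq_of_add_eq_add_of_dist_lt hc hL hΛ hlip hinv ?_ hxy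
    rw [Metric.mem_ball] at hx hy
    linarith [dist_triangle_right x y z]

theorem exists_abs_integral_mul_comp_sub_le (d : ℕ) {K : ℝ} (hK : 0 < K) :
    ∃ N : ℝ, 0 ≤ N ∧ ∀ ε : ℝ, 0 < ε → ε ≤ K →
      ∀ c : EuclideanSpace ℝ (Fin d) → EuclideanSpace ℝ (Fin d),
      Differentiable ℝ c → (∀ i j, Differentiable ℝ (pd j (fun y => c y i))) →
      (∀ i x, |c x i| ≤ ε) → (∀ i j x, |pd j (fun y => c y i) x| ≤ ε) →
      (∀ i j k x, |pd k (pd j (fun y => c y i)) x| ≤ ε) →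
      (∀ x, K⁻¹ ≤ |(1 + jac c x).det|) →
      ∀ φ F : EuclideanSpace ℝ (Fin d) → ℝ, Differentiable ℝ φ → (∀ x, |φ x| ≤ ε) →
      (∀ j x, |pd j φ x| ≤ ε) → Continuous F → Integrable F →
        |∫ x, φ x * (F (x + c x) - F x)| ≤ N * ε ^ 2 * ∫ x, |F x| := by
  obtain ⟨P, hP, hPle⟩ := exists_lintegral_comp_add_le d hK
  obtain ⟨δ, hδ, C, hC, hdetle⟩ := exists_abs_det_one_add_sub_one_le d
  set δ' : ℝ := min δ (1 / (2 * (d * d + 1))) with hδ'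
  have hδ'pos : 0 < δ' := by positivity
  set p := P.toReal with hp
  have hp0 : 0 ≤ p := ENNReal.toReal_nonneg
  refine ⟨(d * d + C) * p + (p + 1) / δ', by positivity, ?_⟩
  intro ε hε hεK c hc hpd h0 h1 h2 hdet φ F hφ hφ0 hφ1 hF hFi
  have hcomp := hPle c hc hpd (fun i x => (h0 i x).trans hεK) (fun i j x => (h1 i j x).trans hεK)
    (fun i j k x => (h2 i j k x).trans hεK) hdet (fun x => ‖F x‖ₑ) hF.measurable.enorm
  have hτc : Continuous fun x => x + c x := continuous_id.add hc.continuous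
  have hFτi : Integrable fun x => F (x + c x) := by
    refine ⟨(hF.comp hτc).aestronglyMeasurable, ?_⟩
    exact hcomp.trans_lt (ENNReal.mul_lt_top hP.lt_top hFi.2)
  have hI0 : 0 ≤ ∫ x, |F x| := integral_nonneg fun x => abs_nonneg _
  have hFτ : ∫ x, |F (x + c x)| ≤ p * ∫ x, |F x| := by
    have e1 : ∫ x, |F (x + c x)| = (∫⁻ x, ‖F (x + c x)‖ₑ).toReal :=
      integral_norm_eq_lintegral_enorm hFτi.1
    have e2 : ∫ x, |F x| = (∫⁻ x, ‖F x‖ₑ).toReal := integral_norm_eq_lintegral_enorm hFi.1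
    rw [e1, e2, hp, ← ENNReal.toReal_mul]
    exact ENNReal.toReal_mono (ENNReal.mul_ne_top hP hFi.2.ne) hcomp
  have hφm : AEStronglyMeasurable φ volume := hφ.continuous.aestronglyMeasurable
  have hφF : Integrable fun x => φ x * F x :=
    hFi.bdd_mul hφm (Filter.Eventually.of_forall hφ0)
  have hφFτ : Integrable fun x => φ x * F (x + c x) :=
    hFτi.bdd_mul hφm (Filter.Eventually.of_forall hφ0)
  have hN1 : 0 ≤ (d * d + C) * p * ε ^ 2 * ∫ x, |F x| := by positivity
  have hN2 : 0 ≤ (p + 1) / δ' * ε ^ 2 * ∫ x, |F x| := by positivity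
  rw [add_mul, add_mul]
  rcases le_or_gt ε δ' with hsmall | hlarge
  · refine le_trans ?_ (le_add_of_nonneg_right hN2)
    have hεδ : ε ≤ δ := hsmall.trans (min_le_left _ _)
    have hεd : (d : ℝ) * (d * ε) ≤ 1 / 2 := by
      have : ε ≤ 1 / (2 * (d * d + 1)) := hsmall.trans (min_le_right _ _)
      rw [le_div_iff₀ (by positivity)] at this
      nlinarith
    have hlip : LipschitzWith (1 / 2) c := by
      refine lipschitzWith_of_nnnorm_fderiv_le hc fun x => ?_
      rw [← NNReal.coe_le_coe]
      exact (norm_fderiv_vec_le hc hε.le fun i j => h1 i j x).trans (by simpa using hεd)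
    have hbij := bijective_add_of_lipschitz hlip
    set D : EuclideanSpace ℝ (Fin d) → ℝ := fun x => |(1 + jac c x).det| with hD
    have hderiv : ∀ x ∈ (Set.univ : Set (EuclideanSpace ℝ (Fin d))),
        HasFDerivWithinAt (fun x => x + c x)
          (ContinuousLinearMap.id ℝ (EuclideanSpace ℝ (Fin d)) + fderiv ℝ c x) Set.univ x :=
      fun x _ => ((hasFDerivAt_id x).add (hc x).hasFDerivAt).hasFDerivWithinAt
    have hchange : ∫ x, φ x * F x = ∫ x, D x * (φ (x + c x) * F (x + c x)) := by
      have := integral_image_eq_integral_abs_det_fderiv_smul volume MeasurableSet.univ hderiv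
        hbij.1.injOn (fun x => φ x * F x)
      rw [Set.image_univ, hbij.2.range_eq, Measure.restrict_univ] at this
      simpa only [det_id_add_fderiv hc, smul_eq_mul] using this
    have hchange_i : Integrable fun x => D x * (φ (x + c x) * F (x + c x)) := by
      have := integrableOn_image_iff_integrableOn_abs_det_fderiv_smul volume MeasurableSet.univ
        hderiv hbij.1.injOn (fun x => φ x * F x)
      rw [Set.image_univ, hbij.2.range_eq, integrableOn_univ, integrableOn_univ] at this
      simpa only [det_id_add_fderiv hc, smul_eq_mul] using this.1 hφF
    have hpt : ∀ x, |φ x - D x * φ (x + c x)| ≤ (d * d + C) * ε ^ 2 := by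
      intro x
      have a1 : |φ x - φ (x + c x)| ≤ d * ε * (d * ε) := by
        refine (abs_sub_le_of_pd hε.le hφ hφ1 x (x + c x)).trans ?_
        rw [sub_add_cancel_left, norm_neg]
        gcongr
        exact norm_le_of_forall_abs_le fun i => h0 i x
      have a2 : |(1 - D x) * φ (x + c x)| ≤ C * ε * ε := by
        rw [abs_mul]
        exact mul_le_mul (hdetle _ ε hε.le hεδ fun i j => h1 i j x) (hφ0 _) (abs_nonneg _)
          (by positivity)
      calc |φ x - D x * φ (x + c x)|
          = |(φ x - φ (x + c x)) + (1 - D x) * φ (x + c x)| := by congr 1; ring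
        _ ≤ d * ε * (d * ε) + C * ε * ε := (abs_add_le _ _).trans (add_le_add a1 a2)
        _ = _ := by ring
    calc |∫ x, φ x * (F (x + c x) - F x)|
        = |∫ x, (φ x - D x * φ (x + c x)) * F (x + c x)| := by
          congr 1
          simp only [mul_sub]
          rw [integral_sub hφFτ hφF, hchange, ← integral_sub hφFτ hchange_i]
          refine integral_congr_ae (Filter.Eventually.of_forall fun x => ?_)
          simp only
          ring
      _ ≤ ∫ x, (d * d + C) * ε ^ 2 * |F (x + c x)| := by
          rw [← Real.norm_eq_abs]
          refine norm_integral_le_of_norm_le (hFτi.abs.const_mul ((d * d + C) * ε ^ 2))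
            (Filter.Eventually.of_forall fun x => ?_)
          rw [norm_mul]
          exact mul_le_mul_of_nonneg_right (hpt x) (norm_nonneg _)
      _ ≤ (d * d + C) * ε ^ 2 * (p * ∫ x, |F x|) := by
          rw [integral_const_mul]
          gcongr
      _ = _ := by ring
  · refine le_trans ?_ (le_add_of_nonneg_left hN1)
    calc |∫ x, φ x * (F (x + c x) - F x)|
        ≤ ∫ x, ε * (|F (x + c x)| + |F x|) := by
          have hi : Integrable fun x => ε * (|F (x + c x)| + |F x|) :=
            (hFτi.abs.add hFi.abs).const_mul ε
          rw [← Real.norm_eq_abs]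
          refine norm_integral_le_of_norm_le hi
            (Filter.Eventually.of_forall fun x => ?_)
          rw [norm_mul]
          exact mul_le_mul (hφ0 x) (abs_sub _ _) (norm_nonneg _) hε.le
      _ = ε * ((∫ x, |F (x + c x)|) + ∫ x, |F x|) := by
          rw [integral_const_mul, integral_add hFτi.abs hFi.abs]
      _ ≤ ε * (p * (∫ x, |F x|) + ∫ x, |F x|) := by gcongr
      _ = (p + 1) * ε * 1 * ∫ x, |F x| := by ring
      _ ≤ (p + 1) * ε * (ε / δ') * ∫ x, |F x| := by
          gcongr
          rw [one_le_div hδ'pos]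
          exact hlarge.le
      _ = _ := by ring

theorem mem_midx {d n : ℕ} {ζ : Fin d → ℕ} : ζ ∈ midx d n ↔ ∑ i, ζ i ≤ n := by
  refine ⟨fun h => (Finset.mem_filter.1 h).2, fun h => Finset.mem_filter.2 ⟨?_, h⟩⟩
  refine Finset.mem_image.2 ⟨fun i => ⟨ζ i, ?_⟩, Finset.mem_univ _, rfl⟩
  exact Nat.lt_succ_of_le ((Finset.single_le_sum (f := ζ) (fun _ _ => Nat.zero_le _)
    (Finset.mem_univ i)).trans h)

theorem sum_add_single {d : ℕ} (ζ : Fin d → ℕ) (j : Fin d) :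
    ∑ i, (ζ + Pi.single j 1 : Fin d → ℕ) i = ∑ i, ζ i + 1 := by
  simp [Finset.sum_add_distrib]

/-- Estimate of the commutator-type term `A₁`: there is `N = N(m,d,K)` such that for all
multi-indices `α, β` with `|α| ≤ m`, `0 ≠ β ≤ α` and all `ρ`,
`|∫ ∂^β c^ρ(x) [(∂_ρ∂^{α−β}u · ∂^α u)(x + c(x)) − (∂_ρ∂^{α−β}u · ∂^α u)(x)] dx|
  ≤ N ε² Σ_{|ζ| ≤ m} ∫ |∂^ζ u|² dx`. -/
theorem degenerate_SIDE_stmt8 (d m : ℕ) (hd : 1 ≤ d) (hm : 1 ≤ m) (K : ℝ) (hK : 0 < K) :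
    ∃ N : ℝ, ∀ ε : ℝ, 0 < ε → ε ≤ K →
      ∀ c : EuclideanSpace ℝ (Fin d) → EuclideanSpace ℝ (Fin d),
        ContDiff ℝ ((m : ℕ∞) + 1) c →
        (∀ γ : Fin d → ℕ, (∑ i, γ i) ≤ m + 1 →
          ∀ (i : Fin d) (x : EuclideanSpace ℝ (Fin d)), |mpd γ (fun y => c y i) x| ≤ ε) →
        (∀ (x : EuclideanSpace ℝ (Fin d)), ∀ θ ∈ Set.Icc (0 : ℝ) 1,
          K⁻¹ ≤ |((1 : Matrix (Fin d) (Fin d) ℝ) + θ • jac c x).det|) →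
        ∀ u : EuclideanSpace ℝ (Fin d) → ℝ,
          ContDiff ℝ ((m : ℕ∞) + 1) u → HasCompactSupport u →
          ∀ α β : Fin d → ℕ, (∑ i, α i) ≤ m → β ≠ 0 → (∀ i, β i ≤ α i) →
            ∀ ρ : Fin d,
              |∫ x, mpd β (fun y => c y ρ) x *
                  (mpd (fun i => α i - β i) (pd ρ u) (x + c x) * mpd α u (x + c x) -
                    mpd (fun i => α i - β i) (pd ρ u) x * mpd α u x)| ≤
                N * ε ^ 2 * ∑ ζ ∈ midx d m, ∫ x, |mpd ζ u x| ^ 2 := by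
  obtain ⟨N, hN0, hN⟩ := exists_abs_integral_mul_comp_sub_le d hK
  refine ⟨N, fun ε hε hεK c hc hcb hdet u hu hus α β hα hβ hβα ρ => ?_⟩
  have hc' : ContDiff ℝ (m + 1 : ℕ) c := by exact_mod_cast hc
  have hu' : ContDiff ℝ (m + 1 : ℕ) u := by exact_mod_cast hu
  have hci : ∀ i, ContDiff ℝ (m + 1 : ℕ) (fun y => c y i) := fun i =>
    (EuclideanSpace.proj i : EuclideanSpace ℝ (Fin d) →L[ℝ] ℝ).contDiff.comp hc'
  have hβm : ∑ i, β i ≤ m := (Finset.sum_le_sum fun i _ => hβα i).trans hα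
  have hsub : ∑ i, (α i - β i) + 1 ≤ m := by
    have h1 : ∑ i, (α i - β i) + ∑ i, β i = ∑ i, α i := by
      rw [← Finset.sum_add_distrib]
      exact Finset.sum_congr rfl fun i _ => Nat.sub_add_cancel (hβα i)
    have h2 : 0 < ∑ i, β i := by
      obtain ⟨i, hi⟩ := Function.ne_iff.1 hβ
      exact (Nat.pos_of_ne_zero hi).trans_le
        (Finset.single_le_sum (f := β) (fun _ _ => Nat.zero_le _) (Finset.mem_univ i))
    omega
  set η : Fin d → ℕ := (fun i => α i - β i) + Pi.single ρ 1 with hη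
  have hηm : ∑ i, η i ≤ m := by rw [hη, sum_add_single]; exact hsub
  have hηu : mpd (fun i => α i - β i) (pd ρ u) = mpd η u := by
    have hu1 : ContDiff ℝ (∑ i, (α i - β i) + 1 : ℕ) u :=
      hu'.of_le (by exact_mod_cast (by omega : ∑ i, (α i - β i) + 1 ≤ m + 1))
    rw [mpd_pd _ _ hu1, mpd_add_single _ _ hu1]
  have hone : ∀ i j, pd j (fun y => c y i) = mpd (0 + Pi.single j 1) (fun y => c y i) := by
    intro i j
    rw [mpd_add_single, mpd_zero]
    exact (hci i).of_le (by simp)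
  have htwo : ∀ i j k, pd k (pd j (fun y => c y i)) =
      mpd (0 + Pi.single j 1 + Pi.single k 1) (fun y => c y i) := by
    intro i j k
    rw [mpd_add_single, ← hone]
    refine (hci i).of_le ?_
    rw [sum_add_single]
    simp only [Pi.zero_apply, Finset.sum_const_zero]
    exact_mod_cast (by omega : 0 + 1 + 1 ≤ m + 1)
  have hcont : ∀ ζ : Fin d → ℕ, ∑ i, ζ i ≤ m → Continuous (mpd ζ u) := fun ζ hζ =>
    (ContDiff.mpd (n := 1) ζ
      (hu'.of_le (by exact_mod_cast (by omega : 1 + ∑ i, ζ i ≤ m + 1)))).continuous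
  have hsq : ∀ ζ : Fin d → ℕ, ∑ i, ζ i ≤ m → Integrable fun x => |mpd ζ u x| ^ 2 := by
    intro ζ hζ
    have hs : HasCompactSupport ((fun t : ℝ => |t| ^ 2) ∘ mpd ζ u) :=
      (HasCompactSupport.mpd ζ hus).comp_left (by simp)
    have hs' : Continuous ((fun t : ℝ => |t| ^ 2) ∘ mpd ζ u) :=
      (continuous_abs.pow 2).comp (hcont ζ hζ)
    exact hs'.integrable_of_hasCompactSupport hs
  have hsq_le : ∀ ζ : Fin d → ℕ, ∑ i, ζ i ≤ m →
      ∫ x, |mpd ζ u x| ^ 2 ≤ ∑ ζ ∈ midx d m, ∫ x, |mpd ζ u x| ^ 2 := fun ζ hζ =>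
    Finset.single_le_sum (f := fun ζ => ∫ x, |mpd ζ u x| ^ 2)
      (fun _ _ => integral_nonneg fun _ => by positivity) (mem_midx.2 hζ)
  have hFc : Continuous fun x => mpd η u x * mpd α u x := (hcont η hηm).mul (hcont α hα)
  have hFi : Integrable fun x => mpd η u x * mpd α u x :=
    hFc.integrable_of_hasCompactSupport (HasCompactSupport.mpd η hus).mul_right
  have hFle : ∫ x, |mpd η u x * mpd α u x| ≤ ∑ ζ ∈ midx d m, ∫ x, |mpd ζ u x| ^ 2 := by
    calc ∫ x, |mpd η u x * mpd α u x|
        ≤ ∫ x, (|mpd η u x| ^ 2 + |mpd α u x| ^ 2) / 2 := by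
          refine integral_mono hFi.abs (((hsq η hηm).add (hsq α hα)).div_const 2) fun x => ?_
          simp only [abs_mul]
          nlinarith [sq_nonneg (|mpd η u x| - |mpd α u x|)]
      _ = ((∫ x, |mpd η u x| ^ 2) + ∫ x, |mpd α u x| ^ 2) / 2 := by
          rw [integral_div, integral_add (hsq η hηm) (hsq α hα)]
      _ ≤ _ := by linarith [hsq_le η hηm, hsq_le α hα]
  have hφ : ContDiff ℝ (1 : ℕ) (mpd β (fun y => c y ρ)) := ContDiff.mpd β
    ((hci ρ).of_le (by exact_mod_cast (by omega : 1 + ∑ i, β i ≤ m + 1)))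
  rw [hηu]
  refine (hN ε hε hεK c (hc'.differentiable (by simp)) (fun i j => ?_) (fun i x => ?_)
    (fun i j x => ?_) (fun i j k x => ?_) (fun x => ?_) (mpd β fun y => c y ρ)
    (fun x => mpd η u x * mpd α u x) (hφ.differentiable (by simp)) (fun x => ?_)
    (fun j x => ?_) hFc hFi).trans ?_
  · exact (ContDiff.pd (n := 1) j
      ((hci i).of_le (by exact_mod_cast (by omega : 1 + 1 ≤ m + 1)))).differentiable (by simp)
  · have := hcb 0 (by simp) i x
    rwa [mpd_zero] at this
  · rw [hone]
    exact hcb _ (by rw [sum_add_single]; simp) i x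
  · rw [htwo]
    refine hcb _ ?_ i x
    rw [sum_add_single, sum_add_single]
    simpa using hm
  · simpa using hdet x 1 (by simp)
  · exact hcb β (by omega) ρ x
  · rw [← mpd_add_single]
    · exact hcb _ (by rw [sum_add_single]; omega) ρ x
    · exact (hci ρ).of_le (by exact_mod_cast (by omega : ∑ i, β i + 1 ≤ m + 1))
  · gcongr
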